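/- arXiv:2004.13151 — 2 statements merged into one kernel-verified Lean document; each statement's English description precedes it below -/
import Mathlib

section
/- Let X be a random vector in ℝ^d with finite expectation. Then X is spherically symmetric (i.e., ΓX has the same distribution as X for every orthogonal d×d matrix Γ) if and only if for every c ∈ ℝ and all unit vectors u, v ∈ S^{d-1}, E[(v − (v⊤u)u)⊤ X · 1_{u⊤X ≥ c}] = 0. -/
open MeasureTheory
open scoped ProbabilityTheory RealInnerProductSpace

/-- A random vector is spherically symmetric if its distribution is invariant under
all orthogonal transformations (linear isometries) of `ℝ^d`. -/
def IsSphericallySymmetric {Ω : Type*} [MeasurableSpace Ω] {d : ℕ}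
    (μ : Measure Ω) (X : Ω → EuclideanSpace ℝ (Fin d)) : Prop :=
  ∀ L : EuclideanSpace ℝ (Fin d) ≃ₗᵢ[ℝ] EuclideanSpace ℝ (Fin d),
    Measure.map (fun ω => L (X ω)) μ = Measure.map X μ

/-- If `Z` integrates to zero over every event `{c ≤ Y}`, then it integrates to zero against
every bounded measurable function of `Y`. -/
lemma integral_smul_comp_eq_zero_of_setIntegral_Ici {Ω : Type*} [MeasurableSpace Ω]
    {μ : Measure Ω} {Y Z : Ω → ℝ} (hY : Measurable Y) (hZm : Measurable Z)
    (hZ : Integrable Z μ) (h : ∀ c, ∫ ω in Y ⁻¹' Set.Ici c, Z ω ∂μ = 0)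
    {g : ℝ → ℂ} (hg : Measurable g) {C : ℝ} (hgC : ∀ x, ‖g x‖ ≤ C) :
    ∫ ω, Z ω • g (Y ω) ∂μ = 0 := by
  have hneg : Integrable (fun ω => -Z ω) μ := hZ.neg
  have hnegm : Measurable fun ω => -Z ω := hZm.neg
  have hfin : IsFiniteMeasure (μ.withDensity fun ω => ENNReal.ofReal (Z ω)) :=
    isFiniteMeasure_withDensity_ofReal hZ.2
  have hmap : (μ.withDensity fun ω => ENNReal.ofReal (Z ω)).map Y =
      (μ.withDensity fun ω => ENNReal.ofReal (-Z ω)).map Y := by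
    refine Measure.ext_of_Ici _ _ fun c => ?_
    have hs : MeasurableSet (Y ⁻¹' Set.Ici c) := hY measurableSet_Ici
    rw [Measure.map_apply hY measurableSet_Ici, Measure.map_apply hY measurableSet_Ici,
      withDensity_apply _ hs, withDensity_apply _ hs]
    have hc := h c
    rw [integral_eq_lintegral_pos_part_sub_lintegral_neg_part hZ.integrableOn, sub_eq_zero,
      ENNReal.toReal_eq_toReal_iff' hZ.integrableOn.lintegral_lt_top.ne
        hneg.integrableOn.lintegral_lt_top.ne] at hc
    exact hc
  have hgY : Measurable fun ω => g (Y ω) := hg.comp hY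
  have hint : ∀ {W : Ω → ℝ}, Integrable W μ →
      Integrable (fun ω => (ENNReal.ofReal (W ω)).toReal • g (Y ω)) μ := fun hW =>
    hW.pos_part.smul_bdd C hgY.aestronglyMeasurable (ae_of_all _ fun ω => hgC _)
  have heq := congrArg (fun ρ : Measure ℝ => ∫ y, g y ∂ρ) hmap
  rw [integral_map hY.aemeasurable hg.aestronglyMeasurable,
    integral_map hY.aemeasurable hg.aestronglyMeasurable,
    integral_withDensity_eq_integral_toReal_smul hZm.ennreal_ofReal (by simp),
    integral_withDensity_eq_integral_toReal_smul hnegm.ennreal_ofReal (by simp),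
    ← sub_eq_zero, ← integral_sub (hint hZ) (hint hneg)] at heq
  rw [← heq]
  refine integral_congr_ae (ae_of_all _ fun ω => ?_)
  simp only [← sub_smul, ENNReal.toReal_ofReal']
  congr 1
  rcases le_total 0 (Z ω) with hz | hz <;> simp [hz]

section CharFun

variable {E : Type*} [NormedAddCommGroup E] [InnerProductSpace ℝ E]

/-- Two vectors of equal norm in a space of dimension at least two lie on a common circle
centred at the origin. -/
lemma exists_eq_smul_cos_add_sin [FiniteDimensional ℝ E] (hE : 2 ≤ Module.finrank ℝ E)
    {a b : E} (hab : ‖a‖ = ‖b‖) :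
    ∃ (r θ : ℝ) (u w : E), ‖u‖ = 1 ∧ ‖w‖ = 1 ∧ ⟪u, w⟫ = 0 ∧ a = r • u ∧
      b = r • (Real.cos θ • u + Real.sin θ • w) := by
  have hperp : ∀ u : E, ∃ w : E, ‖w‖ = 1 ∧ ⟪u, w⟫ = 0 := fun u => by
    have hne : (ℝ ∙ u)ᗮ ≠ ⊥ := fun hbot => by
      have htop := Submodule.orthogonal_eq_bot_iff.1 hbot
      have := finrank_span_le_card (R := ℝ) ({u} : Set E)
      rw [htop, finrank_top] at this
      simp at this
      omega
    obtain ⟨w, hw, hw0⟩ := Submodule.exists_mem_ne_zero_of_ne_bot hne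
    refine ⟨‖w‖⁻¹ • w, norm_smul_inv_norm hw0, ?_⟩
    rw [inner_smul_right, Submodule.mem_orthogonal_singleton_iff_inner_right.1 hw, mul_zero]
  have hunit : ∃ u : E, ‖u‖ = 1 ∧ a = ‖a‖ • u := by
    rcases eq_or_ne a 0 with rfl | ha
    · obtain ⟨u, hu, -⟩ := hperp 0
      exact ⟨u, hu, by simp⟩
    · exact ⟨‖a‖⁻¹ • a, norm_smul_inv_norm ha, by
        rw [smul_inv_smul₀ (norm_ne_zero_iff.2 ha)]⟩
  obtain ⟨u, hu, hau⟩ := hunit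
  have huu : ⟪u, u⟫ = 1 := by rw [real_inner_self_eq_norm_sq, hu, one_pow]
  obtain ⟨w, hw, huw, hbw⟩ : ∃ w : E, ‖w‖ = 1 ∧ ⟪u, w⟫ = 0 ∧
      b = ⟪u, b⟫ • u + ‖b - ⟪u, b⟫ • u‖ • w := by
    rcases eq_or_ne (b - ⟪u, b⟫ • u) 0 with h0 | h0
    · obtain ⟨w, hw, huw⟩ := hperp u
      exact ⟨w, hw, huw, by rw [h0, norm_zero, zero_smul, add_zero, ← sub_eq_zero, h0]⟩
    · refine ⟨‖b - ⟪u, b⟫ • u‖⁻¹ • (b - ⟪u, b⟫ • u), norm_smul_inv_norm h0, ?_, ?_⟩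
      · rw [inner_smul_right, inner_sub_right, inner_smul_right, huu]
        ring
      · rw [smul_inv_smul₀ (norm_ne_zero_iff.2 h0)]
        abel
  set x := ⟪u, b⟫
  set y := ‖b - x • u‖
  have hxy : x ^ 2 + y ^ 2 = ‖a‖ ^ 2 := by
    rw [hab, ← real_inner_self_eq_norm_sq b, hbw]
    simp only [inner_add_left, inner_add_right, inner_smul_left, inner_smul_right, huu, huw,
      real_inner_comm u w, real_inner_self_eq_norm_sq w, hw]
    simp
    ring
  have hz : ‖(⟨x, y⟩ : ℂ)‖ = ‖a‖ := by
    rw [Complex.norm_eq_sqrt_sq_add_sq, hxy, Real.sqrt_sq (norm_nonneg _)]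
  refine ⟨‖a‖, Complex.arg ⟨x, y⟩, u, w, hu, hw, huw, hau, ?_⟩
  rw [smul_add, smul_smul, smul_smul, ← hz, Complex.norm_mul_cos_arg, Complex.norm_mul_sin_arg]
  exact hbw

variable [MeasurableSpace E] [BorelSpace E] [SecondCountableTopology E]

/-- If `⟪w, x⟫` integrates to zero over half-spaces with normal `u` for all `w ⊥ u`, then the
characteristic function is constant on circles centred at the origin. -/
lemma charFun_smul_cos_add_sin {ν : Measure E} [IsFiniteMeasure ν]
    (hν : Integrable (fun x => ‖x‖) ν)
    (h : ∀ (c : ℝ) (u w : E), ‖u‖ = 1 → ‖w‖ = 1 → ⟪u, w⟫ = 0 →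
      ∫ x in {x | c ≤ ⟪u, x⟫}, ⟪w, x⟫ ∂ν = 0)
    {u w : E} (hu : ‖u‖ = 1) (hw : ‖w‖ = 1) (huw : ⟪u, w⟫ = 0) (r θ : ℝ) :
    charFun ν (r • (Real.cos θ • u + Real.sin θ • w)) = charFun ν (r • u) := by
  set p : ℝ → E := fun θ => Real.cos θ • u + Real.sin θ • w with hp
  set q : ℝ → E := fun θ => -Real.sin θ • u + Real.cos θ • w with hq
  have hsq : ∀ s t : ℝ, ‖s • u + t • w‖ ^ 2 = s ^ 2 + t ^ 2 := fun s t => by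
    rw [norm_add_sq_real, norm_smul, norm_smul, hu, hw, inner_smul_left, inner_smul_right, huw]
    simp
  have hpn : ∀ t, ‖p t‖ = 1 := fun t => by
    have := hsq (Real.cos t) (Real.sin t)
    rwa [Real.cos_sq_add_sin_sq, pow_eq_one_iff_of_nonneg (norm_nonneg _) two_ne_zero] at this
  have hqn : ∀ t, ‖q t‖ = 1 := fun t => by
    have := hsq (-Real.sin t) (Real.cos t)
    rwa [neg_sq, Real.sin_sq_add_cos_sq, pow_eq_one_iff_of_nonneg (norm_nonneg _) two_ne_zero] at this
  have hpq : ∀ t, ⟪p t, q t⟫ = 0 := fun t => by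
    simp only [hp, hq, inner_add_left, inner_add_right, inner_smul_left, inner_smul_right, huw,
      real_inner_comm u w, real_inner_self_eq_norm_sq, hu, hw]
    simp
    ring
  have hpd : ∀ t, HasDerivAt p (q t) t := fun t =>
    ((Real.hasDerivAt_cos t).smul_const u).add ((Real.hasDerivAt_sin t).smul_const w)
  have hinner : ∀ v : E, Integrable (fun x => ⟪v, x⟫) ν := fun v =>
    (hν.const_mul ‖v‖).mono' (by fun_prop) (ae_of_all _ fun x => norm_inner_le_norm v x)
  have hderiv : ∀ t, HasDerivAt (fun t => charFun ν (r • p t)) 0 t := fun t => by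
    have hF := hasDerivAt_integral_of_dominated_loc_of_deriv_le (μ := ν) (x₀ := t)
      (s := Set.univ) (bound := fun x => |r| * ‖x‖)
      (F := fun t x => Complex.exp ((⟪x, r • p t⟫ : ℝ) * Complex.I))
      (F' := fun t x => Complex.exp ((⟪x, r • p t⟫ : ℝ) * Complex.I) *
        ((⟪x, r • q t⟫ : ℝ) * Complex.I))
      Filter.univ_mem (Filter.Eventually.of_forall fun s => by fun_prop)
      ((integrable_const (1 : ℝ)).mono' (by fun_prop)
        (ae_of_all _ fun x => by rw [Complex.norm_exp_ofReal_mul_I]))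
      (by fun_prop)
      (ae_of_all _ fun x s _ => by
        rw [norm_mul, Complex.norm_exp_ofReal_mul_I, one_mul, norm_mul, Complex.norm_I, mul_one,
          Complex.norm_real]
        refine (norm_inner_le_norm x _).trans_eq ?_
        rw [norm_smul, hqn, mul_one, Real.norm_eq_abs, mul_comm])
      (hν.const_mul _)
      (ae_of_all _ fun x s _ =>
        ((((hasDerivAt_const s x).inner ℝ ((hpd s).const_smul r)).ofReal_comp.mul_const
          Complex.I).cexp).congr_deriv (by simp))
    have hzero := integral_smul_comp_eq_zero_of_setIntegral_Ici (μ := ν)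
      (Y := fun x => ⟪p t, x⟫) (Z := fun x => ⟪q t, x⟫) (by fun_prop) (by fun_prop)
      (hinner _) (fun c => h c (p t) (q t) (hpn t) (hqn t) (hpq t))
      (g := fun y => Complex.exp ((r * y : ℝ) * Complex.I)) (by fun_prop) (C := 1)
      (fun y => (Complex.norm_exp_ofReal_mul_I _).le)
    have hF0 : ∫ x, Complex.exp ((⟪x, r • p t⟫ : ℝ) * Complex.I) *
        ((⟪x, r • q t⟫ : ℝ) * Complex.I) ∂ν = 0 := by
      calc _ = ∫ x, (r * Complex.I) *
            (⟪q t, x⟫ • Complex.exp ((r * ⟪p t, x⟫ : ℝ) * Complex.I)) ∂ν := by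
            refine integral_congr_ae (ae_of_all _ fun x => ?_)
            simp only [inner_smul_right, real_inner_comm x, Complex.real_smul]
            push_cast
            ring
        _ = 0 := by rw [integral_const_mul, hzero, mul_zero]
    simpa only [charFun_apply, hF0] using hF.2
  have := is_const_of_deriv_eq_zero (fun t => (hderiv t).differentiableAt)
    (fun t => (hderiv t).deriv) θ 0
  simpa [hp] using this

/-- If `⟪w, x⟫` integrates to zero over half-spaces with normal `u` for all `w ⊥ u`, then the
measure is invariant under linear isometries. -/
lemma map_linearIsometryEquiv_eq_self [FiniteDimensional ℝ E] (hE : 2 ≤ Module.finrank ℝ E)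
    {ν : Measure E} [IsFiniteMeasure ν] (hν : Integrable (fun x => ‖x‖) ν)
    (h : ∀ (c : ℝ) (u w : E), ‖u‖ = 1 → ‖w‖ = 1 → ⟪u, w⟫ = 0 →
      ∫ x in {x | c ≤ ⟪u, x⟫}, ⟪w, x⟫ ∂ν = 0) (L : E ≃ₗᵢ[ℝ] E) :
    ν.map L = ν := by
  refine Measure.ext_of_charFun (funext fun t => ?_)
  have hmap : charFun (ν.map L) t = charFun ν (L.symm t) := by
    rw [charFun_apply, charFun_apply, integral_map L.continuous.aemeasurable (by fun_prop)]
    simp_rw [L.inner_map_eq_flip]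
  obtain ⟨r, θ, u, w, hu, hw, huw, ha, hb⟩ :=
    exists_eq_smul_cos_add_sin hE (L.symm.norm_map t).symm
  rw [hmap, hb, ha, charFun_smul_cos_add_sin hν h hu hw huw]

end CharFun

theorem stmt2 {Ω : Type*} [MeasureSpace Ω] [IsProbabilityMeasure (ℙ : Measure Ω)]
    {d : ℕ} (hd : 2 ≤ d) (X : Ω → EuclideanSpace ℝ (Fin d)) (hX : Measurable X)
    (hint : Integrable (fun ω => ‖X ω‖) ℙ) :
    IsSphericallySymmetric ℙ X ↔
      ∀ (c : ℝ) (u v : EuclideanSpace ℝ (Fin d)), ‖u‖ = 1 → ‖v‖ = 1 →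
        ∫ ω, (if c ≤ ⟪u, X ω⟫ then ⟪v - ⟪v, u⟫ • u, X ω⟫ else 0) ∂ℙ = 0 := by
  constructor
  · intro hS c u v hu _
    set w := v - ⟪v, u⟫ • u with hw
    have hwu : ⟪w, u⟫ = 0 := by
      rw [hw, inner_sub_left, real_inner_smul_left, real_inner_self_eq_norm_sq, hu]
      ring
    let L := Submodule.reflection (ℝ ∙ w)ᗮ
    have hLu : L u = u := Submodule.reflection_mem_subspace_eq_self
      (Submodule.mem_orthogonal_singleton_iff_inner_right.2 hwu)
    have hLw : L w = -w := Submodule.reflection_orthogonalComplement_singleton_eq_neg w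
    let f : EuclideanSpace ℝ (Fin d) → ℝ := fun x => if c ≤ ⟪u, x⟫ then ⟪w, x⟫ else 0
    have hf : Measurable f :=
      Measurable.ite (measurableSet_le measurable_const (by fun_prop)) (by fun_prop)
        measurable_const
    have hfL : ∀ x, f (L x) = -f x := fun x => by
      have h1 : ⟪u, L x⟫ = ⟪u, x⟫ := by conv_lhs => rw [← hLu, L.inner_map_map]
      have h2 : ⟪w, L x⟫ = -⟪w, x⟫ := by
        rw [← L.inner_map_map w x, hLw, inner_neg_left, neg_neg]
      simp only [f, h1, h2]
      split_ifs <;> simp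
    have hLX : Measurable fun ω => L (X ω) := L.continuous.measurable.comp hX
    have heq := congrArg (fun ρ => ∫ x, f x ∂ρ) (hS L)
    rw [integral_map hLX.aemeasurable hf.aestronglyMeasurable,
      integral_map hX.aemeasurable hf.aestronglyMeasurable] at heq
    simp only [hfL, integral_neg] at heq
    change ∫ ω, f (X ω) = 0
    linarith
  · intro h L
    have hprob := Measure.isProbabilityMeasure_map (μ := ℙ) hX.aemeasurable
    have hmap := map_linearIsometryEquiv_eq_self (ν := Measure.map X ℙ)
      (by simpa using hd)
      ((integrable_map_measure (by fun_prop) hX.aemeasurable).2 hint) (fun c u w hu hw huw => ?_) L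
    · rwa [Measure.map_map L.continuous.measurable hX] at hmap
    · have hs : MeasurableSet {x : EuclideanSpace ℝ (Fin d) | c ≤ ⟪u, x⟫} :=
        measurableSet_le measurable_const (by fun_prop)
      rw [setIntegral_map hs (by fun_prop) hX.aemeasurable, ← integral_indicator (hX hs),
        ← h c u w hu hw]
      refine integral_congr_ae (ae_of_all _ fun ω => ?_)
      simp [Set.indicator_apply, real_inner_comm u w ▸ huw]
end

section
/- Let X be a random vector in ℝ^d with finite expectation. Then X is spherically symmetric if and only if E[(v − (v⊤u)u)⊤ X | u⊤X] = 0 almost surely for all u, v ∈ S^{d-1}. -/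
open MeasureTheory
open scoped ProbabilityTheory RealInnerProductSpace

section Conditional

variable {Ω E : Type*} [MeasurableSpace Ω] {μ : Measure Ω}
  [NormedAddCommGroup E] [InnerProductSpace ℝ E] [MeasurableSpace E] [BorelSpace E] {X : Ω → E}

theorem measurable_inner_left_comp (hX : Measurable X) (u : E) :
    Measurable fun ω => ⟪u, X ω⟫ :=
  (innerSL ℝ u).continuous.measurable.comp hX

theorem comap_inner_le (hX : Measurable X) (u : E) :
    MeasurableSpace.comap (fun ω => ⟪u, X ω⟫) (borel ℝ) ≤ ‹MeasurableSpace Ω› := by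
  rw [← BorelSpace.measurable_eq (α := ℝ)]
  exact (measurable_inner_left_comp hX u).comap_le

theorem integrable_inner_of_integrable_norm (hX : Measurable X)
    (hint : Integrable (fun ω => ‖X ω‖) μ) (v : E) :
    Integrable (fun ω => ⟪v, X ω⟫) μ :=
  (hint.const_mul ‖v‖).mono' (measurable_inner_left_comp hX v).aestronglyMeasurable
    (.of_forall fun ω => norm_inner_le_norm v (X ω))

/-- If the law of `X` is invariant under orthogonal transformations, the component of `X` along `p`
has conditional expectation zero given the component of `X` along any `u` perpendicular to `p`. -/
theorem condExp_inner_eq_zero_of_map_eq [IsFiniteMeasure μ] (hX : Measurable X)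
    (hint : Integrable (fun ω => ‖X ω‖) μ)
    (hsym : ∀ L : E ≃ₗᵢ[ℝ] E, Measure.map (fun ω => L (X ω)) μ = Measure.map X μ)
    {u p : E} (hup : ⟪p, u⟫ = 0) :
    μ[fun ω => ⟪p, X ω⟫ | MeasurableSpace.comap (fun ω => ⟪u, X ω⟫) (borel ℝ)]
      =ᵐ[μ] fun _ => (0 : ℝ) := by
  refine (ae_eq_condExp_of_forall_setIntegral_eq (comap_inner_le hX u)
    (integrable_inner_of_integrable_norm hX hint p) (fun _ _ _ => integrableOn_zero) ?_
    aestronglyMeasurable_zero).symm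
  rintro _ ⟨B, hB, rfl⟩ -
  rw [← BorelSpace.measurable_eq (α := ℝ)] at hB
  set R : E ≃ₗᵢ[ℝ] E := (ℝ ∙ p)ᗮ.reflection
  have hRp : R p = -p := Submodule.reflection_orthogonalComplement_singleton_eq_neg p
  have hRu : R u = u := Submodule.reflection_mem_subspace_eq_self
    (Submodule.mem_orthogonal_singleton_iff_inner_right.2 hup)
  have hinner (q x : E) : ⟪q, R x⟫ = ⟪R q, x⟫ := by
    rw [← R.inner_map_map (R q) x, Submodule.reflection_reflection]
  have hmeas : Measurable fun x : E => ⟪u, x⟫ := (innerSL ℝ u).continuous.measurable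
  have hcont : Continuous fun x : E => ⟪p, x⟫ := (innerSL ℝ p).continuous
  have hset (Y : Ω → E) (hY : Measurable Y) :
      ∫ ω in (fun ω => ⟪u, Y ω⟫) ⁻¹' B, ⟪p, Y ω⟫ ∂μ
        = ∫ x in (fun x : E => ⟪u, x⟫) ⁻¹' B, ⟪p, x⟫ ∂(Measure.map Y μ) :=
    (setIntegral_map (hmeas hB) hcont.measurable.stronglyMeasurable.aestronglyMeasurable
      hY.aemeasurable).symm
  have h := hset (fun ω => R (X ω)) (R.continuous.measurable.comp hX)
  rw [hsym R, ← hset X hX] at h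
  simp only [hinner, hRp, hRu, inner_neg_left, integral_neg] at h
  rw [integral_zero]
  linarith

/-- If `Y` has conditional expectation zero given `⟪u, X⟫`, then `Y` is orthogonal to the characters
of `⟪u, X⟫`. -/
theorem integral_smul_exp_inner_eq_zero [IsFiniteMeasure μ] (hX : Measurable X)
    {Y : Ω → ℝ} (hY : Integrable Y μ) {u : E}
    (h : μ[Y | MeasurableSpace.comap (fun ω => ⟪u, X ω⟫) (borel ℝ)] =ᵐ[μ] fun _ => (0 : ℝ))
    (c : ℝ) :
    ∫ ω, Y ω • Complex.exp ((c * ⟪u, X ω⟫ : ℝ) * Complex.I) ∂μ = 0 := by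
  have hm := comap_inner_le hX u
  have hu : Measurable[MeasurableSpace.comap (fun ω => ⟪u, X ω⟫) (borel ℝ)]
      fun ω => ⟪u, X ω⟫ := by
    rw [← BorelSpace.measurable_eq (α := ℝ)]
    exact comap_measurable _
  have hexp : Measurable fun s : ℝ => Complex.exp ((c * s : ℝ) * Complex.I) := by fun_prop
  have hpull := condExp_stronglyMeasurable_bilin_of_bound
    (ContinuousLinearMap.lsmul ℝ ℝ (E := ℂ)).flip hm
    (hexp.comp hu).stronglyMeasurable hY 1
    (.of_forall fun ω => (Complex.norm_exp_ofReal_mul_I _).le)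
  have hint := integral_condExp (μ := μ) hm
    (f := fun ω => Y ω • Complex.exp ((c * ⟪u, X ω⟫ : ℝ) * Complex.I))
  rw [← hint]
  refine integral_eq_zero_of_ae (hpull.trans ?_)
  filter_upwards [h] with ω hω
  simp [hω]

theorem charFun_map_eq_integral (hX : Measurable X) (t : E) :
    charFun (Measure.map X μ) t = ∫ ω, Complex.exp (⟪t, X ω⟫ * Complex.I) ∂μ := by
  have hcont : Continuous fun x : E => ⟪t, x⟫ := (innerSL ℝ t).continuous
  simp_rw [charFun_apply, real_inner_comm]
  exact integral_map hX.aemeasurable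
    (by fun_prop : Measurable _).stronglyMeasurable.aestronglyMeasurable

/-- If the conditional expectations of perpendicular components vanish, the characteristic function
is constant along great circles. -/
theorem charFun_map_great_circle [IsFiniteMeasure μ] (hX : Measurable X)
    (hint : Integrable (fun ω => ‖X ω‖) μ)
    (h : ∀ u v : E, ‖u‖ = 1 → ‖v‖ = 1 → ⟪v, u⟫ = 0 →
      μ[fun ω => ⟪v, X ω⟫ | MeasurableSpace.comap (fun ω => ⟪u, X ω⟫) (borel ℝ)]
        =ᵐ[μ] fun _ => (0 : ℝ))
    {a b : E} (ha : ‖a‖ = 1) (hb : ‖b‖ = 1) (hab : ⟪a, b⟫ = 0) (c θ : ℝ) :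
    charFun (Measure.map X μ) (c • (Real.cos θ • a + Real.sin θ • b))
      = charFun (Measure.map X μ) (c • a) := by
  set γ : ℝ → E := fun θ => Real.cos θ • a + Real.sin θ • b with hγ
  set γ' : ℝ → E := fun θ => -Real.sin θ • a + Real.cos θ • b with hγ'
  have hba : ⟪b, a⟫ = 0 := by rw [real_inner_comm, hab]
  have haa : ⟪a, a⟫ = 1 := by rw [real_inner_self_eq_norm_sq, ha, one_pow]
  have hbb : ⟪b, b⟫ = 1 := by rw [real_inner_self_eq_norm_sq, hb, one_pow]
  have hunit (v : E) (hv : ⟪v, v⟫ = 1) : ‖v‖ = 1 := by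
    rw [norm_eq_sqrt_real_inner, hv, Real.sqrt_one]
  have hγ1 (θ : ℝ) : ‖γ θ‖ = 1 := hunit _ <| by
    simp only [hγ, inner_add_left, inner_add_right, real_inner_smul_left, real_inner_smul_right,
      haa, hbb, hab, hba]
    linear_combination Real.cos_sq_add_sin_sq θ
  have hγ'1 (θ : ℝ) : ‖γ' θ‖ = 1 := hunit _ <| by
    simp only [hγ', inner_add_left, inner_add_right, real_inner_smul_left, real_inner_smul_right,
      haa, hbb, hab, hba]
    linear_combination Real.cos_sq_add_sin_sq θ
  have hperp (θ : ℝ) : ⟪γ' θ, γ θ⟫ = 0 := by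
    simp only [hγ, hγ', inner_add_left, inner_add_right, real_inner_smul_left,
      real_inner_smul_right, haa, hbb, hab, hba]
    ring
  have hderiv (x : E) (θ : ℝ) : HasDerivAt (fun θ => ⟪γ θ, x⟫) ⟪γ' θ, x⟫ θ := by
    simp only [hγ, hγ', inner_add_left, real_inner_smul_left]
    exact ((Real.hasDerivAt_cos θ).mul_const _).add ((Real.hasDerivAt_sin θ).mul_const _)
  set F : ℝ → Ω → ℂ := fun θ ω => Complex.exp ((c * ⟪γ θ, X ω⟫ : ℝ) * Complex.I) with hF
  set F' : ℝ → Ω → ℂ := fun θ ω => (c * Complex.I) * (⟪γ' θ, X ω⟫ • F θ ω) with hF'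
  have hFmeas (θ : ℝ) : Measurable (F θ) := by
    have := measurable_inner_left_comp hX (γ θ)
    fun_prop
  have hF'meas (θ : ℝ) : Measurable (F' θ) := by
    have := measurable_inner_left_comp hX (γ' θ)
    have := hFmeas θ
    fun_prop
  have hFnorm (θ : ℝ) (ω : Ω) : ‖F θ ω‖ = 1 := Complex.norm_exp_ofReal_mul_I _
  have hFderiv (θ : ℝ) : HasDerivAt (fun θ => ∫ ω, F θ ω ∂μ) 0 θ := by
    have hzero : ∫ ω, F' θ ω ∂μ = 0 := by
      rw [integral_const_mul, integral_smul_exp_inner_eq_zero hX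
        (integrable_inner_of_integrable_norm hX hint _)
        (h (γ θ) (γ' θ) (hγ1 θ) (hγ'1 θ) (hperp θ)) c, mul_zero]
    rw [← hzero]
    refine (hasDerivAt_integral_of_dominated_loc_of_deriv_le (bound := fun ω => |c| * ‖X ω‖)
      Filter.univ_mem (.of_forall fun θ => (hFmeas θ).aestronglyMeasurable)
      (.of_bound (hFmeas θ).aestronglyMeasurable 1 (.of_forall fun ω => (hFnorm θ ω).le))
      (hF'meas θ).aestronglyMeasurable (.of_forall fun ω θ _ => ?_) (hint.const_mul _)
      (.of_forall fun ω θ _ => ?_)).2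
    · have : |⟪γ' θ, X ω⟫| ≤ ‖X ω‖ := by
        simpa [hγ'1] using abs_real_inner_le_norm (γ' θ) (X ω)
      simp only [hF', norm_mul, norm_smul, hFnorm, Complex.norm_I, Complex.norm_real,
        Real.norm_eq_abs, mul_one]
      gcongr
    · refine (((((hderiv (X ω) θ).const_mul c).ofReal_comp).mul_const
        Complex.I).cexp).congr_deriv ?_
      simp only [hF', hF, Complex.real_smul]
      push_cast
      ring
  have hconst := is_const_of_deriv_eq_zero (fun θ => (hFderiv θ).differentiableAt)
    (fun θ => (hFderiv θ).deriv) θ 0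
  rw [charFun_map_eq_integral hX, charFun_map_eq_integral hX]
  simpa [hF, hγ, real_inner_smul_left, -smul_add] using hconst

end Conditional

/-- Any two unit vectors in dimension at least two lie on a common great circle. -/
theorem exists_eq_cos_smul_add_sin_smul {E : Type*} [NormedAddCommGroup E] [InnerProductSpace ℝ E]
    [FiniteDimensional ℝ E] (hE : 2 ≤ Module.finrank ℝ E) {x y : E} (hx : ‖x‖ = 1)
    (hy : ‖y‖ = 1) :
    ∃ b : E, ‖b‖ = 1 ∧ ⟪x, b⟫ = 0 ∧ ∃ θ : ℝ, y = Real.cos θ • x + Real.sin θ • b := by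
  have hxx : ⟪x, x⟫ = 1 := by rw [real_inner_self_eq_norm_sq, hx, one_pow]
  have hyy : ⟪y, y⟫ = 1 := by rw [real_inner_self_eq_norm_sq, hy, one_pow]
  set p : E := y - ⟪x, y⟫ • x with hp
  obtain ⟨q, hq0, hxq, s, hs⟩ : ∃ q : E, q ≠ 0 ∧ ⟪x, q⟫ = 0 ∧ ∃ s : ℝ, p = s • q := by
    by_cases hp0 : p = 0
    · have hrank := (ℝ ∙ x).finrank_add_finrank_orthogonal
      have hspan := finrank_span_singleton (K := ℝ) (v := x) (by rintro rfl; simp at hx)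
      have : (ℝ ∙ x)ᗮ ≠ ⊥ := by
        intro hbot
        rw [hbot, finrank_bot] at hrank
        omega
      obtain ⟨q, hq, hq0⟩ := Submodule.exists_mem_ne_zero_of_ne_bot this
      exact ⟨q, hq0, Submodule.mem_orthogonal_singleton_iff_inner_right.1 hq, 0, by simp [hp0]⟩
    · refine ⟨p, hp0, ?_, 1, (one_smul _ _).symm⟩
      rw [hp, inner_sub_right, real_inner_smul_right, hxx, mul_one, sub_self]
  have hqn : ‖q‖ ≠ 0 := norm_ne_zero_iff.2 hq0
  set b : E := ‖q‖⁻¹ • q with hb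
  have hb1 : ‖b‖ = 1 := norm_smul_inv_norm hq0
  have hxb : ⟪x, b⟫ = 0 := by rw [hb, real_inner_smul_right, hxq, mul_zero]
  have hbx : ⟪b, x⟫ = 0 := by rw [real_inner_comm, hxb]
  have hbb : ⟪b, b⟫ = 1 := by rw [real_inner_self_eq_norm_sq, hb1, one_pow]
  have hyeq : y = ⟪x, y⟫ • x + (s * ‖q‖) • b := by
    rw [hb, smul_smul, mul_assoc, mul_inv_cancel₀ hqn, mul_one, ← hs, hp, add_sub_cancel]
  generalize ⟪x, y⟫ = r at hyeq
  generalize s * ‖q‖ = t at hyeq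
  have hrt : r ^ 2 + t ^ 2 = 1 := by
    rw [hyeq] at hyy
    simp only [inner_add_left, inner_add_right, real_inner_smul_left, real_inner_smul_right,
      hxx, hbb, hxb, hbx] at hyy
    linear_combination hyy
  have hnorm : ‖(⟨r, t⟩ : ℂ)‖ = 1 := by
    rw [Complex.norm_eq_sqrt_sq_add_sq, hrt, Real.sqrt_one]
  refine ⟨b, hb1, hxb, Complex.arg ⟨r, t⟩, ?_⟩
  rw [Complex.cos_arg (norm_ne_zero_iff.1 (by simp [hnorm])), Complex.sin_arg, hnorm, div_one,
    div_one]
  exact hyeq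

/-- If the conditional expectations of perpendicular components vanish, the law is invariant under
orthogonal transformations. -/
theorem map_eq_of_condExp_inner_eq_zero {Ω E : Type*} [MeasurableSpace Ω] {μ : Measure Ω}
    [IsFiniteMeasure μ] [NormedAddCommGroup E] [InnerProductSpace ℝ E] [FiniteDimensional ℝ E]
    [MeasurableSpace E] [BorelSpace E] (hE : 2 ≤ Module.finrank ℝ E) {X : Ω → E}
    (hX : Measurable X) (hint : Integrable (fun ω => ‖X ω‖) μ)
    (h : ∀ u v : E, ‖u‖ = 1 → ‖v‖ = 1 → ⟪v, u⟫ = 0 →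
      μ[fun ω => ⟪v, X ω⟫ | MeasurableSpace.comap (fun ω => ⟪u, X ω⟫) (borel ℝ)]
        =ᵐ[μ] fun _ => (0 : ℝ))
    (L : E ≃ₗᵢ[ℝ] E) :
    Measure.map (fun ω => L (X ω)) μ = Measure.map X μ := by
  refine Measure.ext_of_charFun (funext fun t => ?_)
  have hLt : charFun (Measure.map (fun ω => L (X ω)) μ) t
      = charFun (Measure.map X μ) (L.symm t) := by
    rw [charFun_map_eq_integral (X := fun ω => L (X ω)) (L.continuous.measurable.comp hX),
      charFun_map_eq_integral hX]
    simp_rw [← L.inner_map_map (L.symm t), L.apply_symm_apply]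
  rw [hLt]
  rcases eq_or_ne t 0 with rfl | ht
  · rw [map_zero]
  have htn : ‖t‖ ≠ 0 := norm_ne_zero_iff.2 ht
  have hx : ‖‖t‖⁻¹ • t‖ = 1 := norm_smul_inv_norm ht
  obtain ⟨b, hb, hxb, θ, hθ⟩ := exists_eq_cos_smul_add_sin_smul hE hx
    ((L.symm.norm_map _).trans hx)
  have hcircle := charFun_map_great_circle hX hint h hx hb hxb ‖t‖ θ
  rwa [← hθ, ← map_smul, smul_inv_smul₀ htn] at hcircle

theorem stmt3 {Ω : Type*} [MeasureSpace Ω] [IsProbabilityMeasure (ℙ : Measure Ω)]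
    {d : ℕ} (hd : 2 ≤ d) (X : Ω → EuclideanSpace ℝ (Fin d)) (hX : Measurable X)
    (hint : Integrable (fun ω => ‖X ω‖) ℙ) :
    IsSphericallySymmetric ℙ X ↔
      ∀ u v : EuclideanSpace ℝ (Fin d), ‖u‖ = 1 → ‖v‖ = 1 →
        (ℙ : Measure Ω)[fun ω => ⟪v - ⟪v, u⟫ • u, X ω⟫ |
            MeasurableSpace.comap (fun ω => ⟪u, X ω⟫) (borel ℝ)]
          =ᵐ[ℙ] (fun _ => (0 : ℝ)) := by
  constructor
  · intro hsym u v hu _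
    refine condExp_inner_eq_zero_of_map_eq hX hint hsym ?_
    rw [inner_sub_left, real_inner_smul_left, real_inner_self_eq_norm_sq, hu, one_pow, mul_one,
      sub_self]
  · intro h
    refine map_eq_of_condExp_inner_eq_zero (by simpa using hd) hX hint fun u v hu hv hvu => ?_
    simpa only [hvu, zero_smul, sub_zero] using h u v hu hv
end
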